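/- Let h : ℝ^d → ℝ be ρ-weakly convex (ρ ≥ 0), let f : ℝ^d → ℝ be L-smooth, let α > 0 with αρ < 1, and let z₀, Δ ∈ ℝ^d. If z⁺ is a minimizer over ℝ^d of z ↦ h(z) + (1/(2α))‖z − (z₀ − αΔ)‖², and we set G := (z₀ − z⁺)/α, then f(z⁺) + h(z⁺) − f(z₀) − h(z₀) ≤ α‖Δ − ∇f(z₀)‖² − ((3α − 2(ρ+L)α²)/4)·‖G‖². -/

import Mathlib

open scoped RealInnerProductSpace

section

variable {E : Type*} [NormedAddCommGroup E] [InnerProductSpace ℝ E]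

/-- The descent lemma: the quadratic upper bound for a function with Lipschitz gradient. -/
lemma le_add_inner_gradient_add_sq [CompleteSpace E] {f : E → ℝ} {L : ℝ}
    (hf : Differentiable ℝ f)
    (hL : ∀ x y, ‖gradient f x - gradient f y‖ ≤ L * ‖x - y‖) (x v : E) :
    f (x + v) ≤ f x + ⟪gradient f x, v⟫ + L / 2 * ‖v‖ ^ 2 := by
  have hderiv : ∀ t : ℝ, HasDerivAt
      (fun t : ℝ => f (x + t • v) - t * ⟪gradient f x, v⟫ - L / 2 * ‖v‖ ^ 2 * t ^ 2)
      (⟪gradient f (x + t • v), v⟫ - ⟪gradient f x, v⟫ - L * ‖v‖ ^ 2 * t) t := by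
    intro t
    have hline : HasDerivAt (fun t : ℝ => x + t • v) v t := by
      simpa using ((hasDerivAt_id t).smul_const v).const_add x
    have hcomp : HasDerivAt (fun t : ℝ => f (x + t • v)) ⟪gradient f (x + t • v), v⟫ t := by
      exact (hf (x + t • v)).hasGradientAt.hasFDerivAt.comp_hasDerivAt t hline
    refine ((hcomp.sub ((hasDerivAt_id t).mul_const ⟪gradient f x, v⟫)).sub
      ((hasDerivAt_pow 2 t).const_mul (L / 2 * ‖v‖ ^ 2))).congr_deriv ?_
    push_cast
    ring
  have hanti := antitoneOn_of_deriv_nonpos (convex_Icc (0 : ℝ) 1)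
    (fun t _ => (hderiv t).continuousAt.continuousWithinAt)
    (fun t _ => (hderiv t).differentiableAt.differentiableWithinAt)
    (fun t ht => by
      rw [interior_Icc] at ht
      rw [(hderiv t).deriv, ← inner_sub_left]
      have hgrad := hL (x + t • v) x
      rw [add_sub_cancel_left, norm_smul, Real.norm_of_nonneg ht.1.le] at hgrad
      nlinarith [real_inner_le_norm (gradient f (x + t • v) - gradient f x) v,
        mul_le_mul_of_nonneg_right hgrad (norm_nonneg v)])
  have hle := hanti (Set.left_mem_Icc.2 zero_le_one) (Set.right_mem_Icc.2 zero_le_one) zero_le_one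
  simp only [one_smul, zero_smul, add_zero] at hle
  linarith

/-- A weakly convex function along a segment. -/
lemma weaklyConvex_segment_le {h : E → ℝ} {ρ : ℝ}
    (hwc : ConvexOn ℝ Set.univ (fun z => h z + ρ / 2 * ‖z‖ ^ 2)) (x v : E) {t : ℝ}
    (ht₀ : 0 ≤ t) (ht₁ : t ≤ 1) :
    h (x + t • v) ≤ (1 - t) * h x + t * h (x + v) + ρ / 2 * (t * (1 - t)) * ‖v‖ ^ 2 := by
  have hconv := hwc.2 (Set.mem_univ x) (Set.mem_univ (x + v)) (sub_nonneg.2 ht₁) ht₀ (by ring)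
  have hpoint : (1 - t) • x + t • (x + v) = x + t • v := by module
  simp only [hpoint, smul_eq_mul, norm_add_sq_real, real_inner_smul_right, norm_smul, mul_pow,
    Real.norm_eq_abs, sq_abs] at hconv
  linarith

/-- Comparison of a proximal step on a weakly convex function with its starting point. -/
lemma prox_weaklyConvex_le {h : E → ℝ} {ρ α : ℝ} (hα : 0 < α) (hαρ : α * ρ < 1)
    (hwc : ConvexOn ℝ Set.univ (fun z => h z + ρ / 2 * ‖z‖ ^ 2)) {z₀ Δ zp : E}
    (hmin : IsMinOn (fun z => h z + 1 / (2 * α) * ‖z - (z₀ - α • Δ)‖ ^ 2) Set.univ zp) :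
    h zp - h z₀ ≤ ⟪Δ, z₀ - zp⟫ + (ρ / 2 - 1 / α) * ‖z₀ - zp‖ ^ 2 := by
  obtain ⟨u, rfl⟩ : ∃ u, z₀ = zp + u := ⟨z₀ - zp, by simp⟩
  rw [add_sub_cancel_left]
  set A := h zp - h (zp + u) - (⟪Δ, u⟫ + (ρ / 2 - 1 / α) * ‖u‖ ^ 2) with hA
  set B := (1 / (2 * α) - ρ / 2) * ‖u‖ ^ 2 with hB
  have hB₀ : 0 ≤ B := by
    have hfactor : 1 / (2 * α) - ρ / 2 = (1 - α * ρ) / (2 * α) := by field_simp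
    rw [hB, hfactor]
    have := sub_pos.2 hαρ
    positivity
  have hAB : ∀ t : ℝ, 0 < t → t ≤ 1 → A ≤ t * B := by
    intro t ht₀ ht₁
    have hle := isMinOn_iff.1 hmin (zp + t • u) (Set.mem_univ _)
    have hseg := weaklyConvex_segment_le hwc zp u ht₀.le ht₁
    have hstart : zp - (zp + u - α • Δ) = α • Δ - u := by module
    have hmove : zp + t • u - (zp + u - α • Δ) = (α • Δ - u) + t • u := by module
    simp only [hstart, hmove] at hle
    rw [norm_add_sq_real (α • Δ - u), inner_smul_right, inner_sub_left, real_inner_smul_left,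
      real_inner_self_eq_norm_sq, norm_smul t, mul_pow, Real.norm_eq_abs, sq_abs] at hle
    have hexpand : 1 / (2 * α) * (‖α • Δ - u‖ ^ 2 + 2 * (t * (α * ⟪Δ, u⟫ - ‖u‖ ^ 2))
        + t ^ 2 * ‖u‖ ^ 2) = 1 / (2 * α) * ‖α • Δ - u‖ ^ 2 + t * (⟪Δ, u⟫ - 1 / α * ‖u‖ ^ 2)
        + t ^ 2 * (1 / (2 * α) * ‖u‖ ^ 2) := by
      field_simp
    refine le_of_mul_le_mul_left ?_ ht₀
    rw [hA, hB]
    linarith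
  by_contra! hneg
  have hA₀ : 0 < A := sub_pos.2 hneg
  have hs : 0 < 2 * (A + B) := by positivity
  have hle := hAB (A / (2 * (A + B))) (by positivity) ((div_le_one hs).2 (by linarith))
  rw [div_mul_eq_mul_div, le_div_iff₀ hs] at hle
  nlinarith [mul_pos hA₀ hA₀, mul_nonneg hA₀.le hB₀]

end

/-- If `h` is `ρ`-weakly convex, `f` is `L`-smooth, `α > 0` with `αρ < 1`, `z⁺` minimizes
`z ↦ h(z) + (1/(2α))‖z − (z₀ − αΔ)‖²`, and `G := (z₀ − z⁺)/α`, then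
`f(z⁺) + h(z⁺) − f(z₀) − h(z₀) ≤ α‖Δ − ∇f(z₀)‖² − ((3α − 2(ρ+L)α²)/4)‖G‖²`. -/
theorem prox_composite_descent {d : ℕ} {ρ α L : ℝ}
    (hρ : 0 ≤ ρ) (hα : 0 < α) (hαρ : α * ρ < 1) (hL : 0 ≤ L)
    (h : EuclideanSpace ℝ (Fin d) → ℝ)
    (hwc : ConvexOn ℝ Set.univ (fun z => h z + ρ / 2 * ‖z‖ ^ 2))
    (f : EuclideanSpace ℝ (Fin d) → ℝ)
    (hfdiff : Differentiable ℝ f)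
    (hfsmooth : ∀ x y, ‖gradient f x - gradient f y‖ ≤ L * ‖x - y‖)
    (z0 Δ zp : EuclideanSpace ℝ (Fin d))
    (hmin : IsMinOn (fun z => h z + 1 / (2 * α) * ‖z - (z0 - α • Δ)‖ ^ 2) Set.univ zp) :
    f zp + h zp - f z0 - h z0 ≤
      α * ‖Δ - gradient f z0‖ ^ 2
        - (3 * α - 2 * (ρ + L) * α ^ 2) / 4 * ‖α⁻¹ • (z0 - zp)‖ ^ 2 := by
  have hprox := prox_weaklyConvex_le hα hαρ hwc hmin
  have hdescent := le_add_inner_gradient_add_sq hfdiff hfsmooth z0 (zp - z0)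
  rw [add_sub_cancel, ← neg_sub z0 zp, inner_neg_right, norm_neg] at hdescent
  have hyoung : ⟪Δ - gradient f z0, z0 - zp⟫ ≤
      α * ‖Δ - gradient f z0‖ ^ 2 + 1 / (4 * α) * ‖z0 - zp‖ ^ 2 := by
    have hsq : α * ‖Δ - gradient f z0‖ ^ 2 + 1 / (4 * α) * ‖z0 - zp‖ ^ 2
        - ‖Δ - gradient f z0‖ * ‖z0 - zp‖
        = (2 * α * ‖Δ - gradient f z0‖ - ‖z0 - zp‖) ^ 2 / (4 * α) := by
      field_simp
      ring
    have hnonneg : 0 ≤ (2 * α * ‖Δ - gradient f z0‖ - ‖z0 - zp‖) ^ 2 / (4 * α) := by positivity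
    linarith [real_inner_le_norm (Δ - gradient f z0) (z0 - zp)]
  rw [inner_sub_left] at hyoung
  have hG : (3 * α - 2 * (ρ + L) * α ^ 2) / 4 * ‖α⁻¹ • (z0 - zp)‖ ^ 2
      = (1 / α - 1 / (4 * α) - (ρ + L) / 2) * ‖z0 - zp‖ ^ 2 := by
    rw [norm_smul, norm_inv, Real.norm_of_nonneg hα.le]
    field_simp
    ring
  rw [hG]
  linarith
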